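/- arXiv:2310.20124 — 2 statements merged into one kernel-verified Lean document; each statement's English description precedes it below -/
import Mathlib

section
/- Let E be a finite set, C ⊊ E a proper subset with |C| ≡ 1 (mod 4), and let F := (E∖C) ⊔ {∗} be obtained from the complement of C by adjoining one extra element. Then there exists an injective 𝔽₂-linear map ψ : H_F → H_E such that q_E(ψ(y)) = q_F(y) for all y ∈ H_F, the image of ψ is orthogonal (for the polar form b of q_E) to the subspace H_C ⊆ H_E (included via extension by 0), and H_E = H_C ⊕ ψ(H_F). In other words, H_E is isometric to the orthogonal direct sum H_C ⊥ H_F. -/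
open Finset

abbrev F2 := ZMod 2

/-- `H_E`: the 𝔽₂-vector space of functions `v : E → 𝔽₂` with `∑ e, v e = 0`
(characteristic functions of even-size subsets of `E`). -/
def HE (E : Type*) [Fintype E] : Submodule F2 (E → F2) where
  carrier := {v | ∑ e, v e = 0}
  zero_mem' := by simp
  add_mem' := by
    intro a b ha hb
    simp only [Set.mem_setOf_eq] at ha hb ⊢
    simp [Finset.sum_add_distrib, ha, hb]
  smul_mem' := by
    intro c v hv
    simp only [Set.mem_setOf_eq] at hv ⊢
    simp [← Finset.mul_sum, hv]

/-- The quadratic form `q_E`, determined by `q_E(χ_A) = (|A|/2) mod 2` for even-size `A`. -/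
def qE {E : Type*} [Fintype E] [DecidableEq E] (v : E → F2) : F2 :=
  (((Finset.univ : Finset E).powersetCard 2).filter (fun p => ∀ e ∈ p, v e = 1)).card

/-- The polar form `b(v,w) = q_E(v+w) - q_E(v) - q_E(w)` of `q_E`. -/
def bE {E : Type*} [Fintype E] [DecidableEq E] (v w : E → F2) : F2 :=
  qE (v + w) - qE v - qE w

/-- `F := (E ∖ C) ⊔ {∗}`. -/
abbrev Fc (E : Type*) [Fintype E] [DecidableEq E] (C : Finset E) : Type _ :=
  {e : E // e ∉ C} ⊕ Unit

/-- The number of points where an 𝔽₂-valued function takes the value `1`. -/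
def weight {E : Type*} [Fintype E] (v : E → F2) : ℕ :=
  ∑ e, if v e = 1 then 1 else 0

theorem weight_eq_card {E : Type*} [Fintype E] (v : E → F2) :
    weight v = (Finset.univ.filter (fun e => v e = 1)).card := by
  simp [weight]

theorem qE_eq_choose {E : Type*} [Fintype E] [DecidableEq E] (v : E → F2) :
    qE v = ((weight v).choose 2 : ℕ) := by
  rw [qE, weight_eq_card, ← Finset.card_powersetCard]
  congr 2
  ext p
  simp [Finset.mem_powersetCard, Finset.subset_iff, and_comm]

theorem F2.ite_eq_self (a : F2) : (if a = 1 then 1 else 0 : F2) = a := by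
  revert a; decide

theorem natCast_weight {E : Type*} [Fintype E] (v : E → F2) :
    (weight v : F2) = ∑ e, v e := by
  simp only [weight, Nat.cast_sum, Nat.cast_ite, Nat.cast_one, Nat.cast_zero, F2.ite_eq_self]

theorem mem_HE_iff {E : Type*} [Fintype E] (v : E → F2) : v ∈ HE E ↔ ∑ e, v e = 0 :=
  Iff.rfl

theorem even_weight {E : Type*} [Fintype E] {v : E → F2} (hv : v ∈ HE E) :
    Even (weight v) := by
  rw [← ZMod.natCast_eq_zero_iff_even, natCast_weight]
  exact hv

theorem weight_add {E : Type*} [Fintype E] (v w : E → F2) :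
    weight (v + w) + 2 * weight (v * w) = weight v + weight w := by
  have key : ∀ a b : F2, (if a + b = 1 then 1 else 0) + 2 * (if a * b = 1 then 1 else 0) =
      (if a = 1 then 1 else 0) + (if b = 1 then 1 else 0 : ℕ) := by decide
  simp only [weight, Finset.mul_sum, ← Finset.sum_add_distrib, Pi.add_apply, Pi.mul_apply, key]

theorem natCast_choose_two_even (m : ℕ) : (((2 * m).choose 2 : ℕ) : F2) = m := by
  rw [Nat.choose_two_right, mul_assoc, Nat.mul_div_cancel_left _ (by norm_num),
    ZMod.natCast_eq_natCast_iff]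
  rcases m with _ | m
  · rfl
  · rw [show 2 * (m + 1) - 1 = 2 * m + 1 by omega, Nat.ModEq, Nat.mul_mod]
    simp

theorem natCast_choose_two_add_four_mul (n k : ℕ) :
    (((n + 4 * k).choose 2 : ℕ) : F2) = (n.choose 2 : ℕ) := by
  induction k with
  | zero => rfl
  | succ k ih =>
    rw [← ih, show n + 4 * (k + 1) = n + 4 * k + 4 by ring, ZMod.natCast_eq_natCast_iff]
    have h : ∀ m : ℕ, (m + 1).choose 2 = m + m.choose 2 := fun m => by
      rw [Nat.choose_succ_succ' m 1, Nat.choose_one_right]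
    simp only [h, Nat.ModEq]
    omega

theorem bE_eq_sum {E : Type*} [Fintype E] [DecidableEq E] {v w : E → F2}
    (hv : v ∈ HE E) (hw : w ∈ HE E) : bE v w = ∑ e, v e * w e := by
  obtain ⟨a, ha⟩ := (even_weight hv).two_dvd
  obtain ⟨b, hb⟩ := (even_weight hw).two_dvd
  obtain ⟨c, hc⟩ := (even_weight ((HE E).add_mem hv hw)).two_dvd
  have hadd := weight_add v w
  rw [ha, hb, hc] at hadd
  have hsum : c + weight (v * w) = a + b := by omega
  have hcast : (c : F2) + weight (v * w) = a + b := by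
    simpa only [Nat.cast_add] using congrArg (Nat.cast : ℕ → F2) hsum
  have hprod : (weight (v * w) : F2) = ∑ e, v e * w e := natCast_weight _
  rw [bE, qE_eq_choose, qE_eq_choose, qE_eq_choose, ha, hb, hc, natCast_choose_two_even,
    natCast_choose_two_even, natCast_choose_two_even, ← hprod]
  generalize (weight (v * w) : F2) = d at *
  generalize (a : F2) = x at *
  generalize (b : F2) = y at *
  generalize (c : F2) = z at *
  clear * - hcast
  revert x y z d
  decide

/-- The pullback of functions along the map `E → (E ∖ C) ⊔ {∗}` collapsing `C` to `∗`. -/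
def collapsePullback {E : Type*} [Fintype E] [DecidableEq E] (C : Finset E) :
    (Fc E C → F2) →ₗ[F2] (E → F2) :=
  LinearMap.funLeft F2 F2 (fun e => if h : e ∉ C then Sum.inl ⟨e, h⟩ else Sum.inr ())

section collapsePullback

variable {E : Type*} [Fintype E] [DecidableEq E] {C : Finset E}

theorem collapsePullback_of_notMem (y : Fc E C → F2) {e : E} (he : e ∉ C) :
    collapsePullback C y e = y (Sum.inl ⟨e, he⟩) := by
  simp [collapsePullback, LinearMap.funLeft_apply, he]

theorem collapsePullback_of_mem (y : Fc E C → F2) {e : E} (he : e ∈ C) :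
    collapsePullback C y e = y (Sum.inr ()) := by
  simp [collapsePullback, LinearMap.funLeft_apply, he]

theorem sum_collapsePullback {M : Type*} [AddCommMonoid M] (f : F2 → M) (y : Fc E C → F2) :
    ∑ e, f (collapsePullback C y e) =
      ∑ x : {e : E // e ∉ C}, f (y (Sum.inl x)) + C.card • f (y (Sum.inr ())) := by
  rw [← Fintype.sum_subtype_add_sum_subtype (fun e => e ∉ C)]
  congr 1
  · exact Finset.sum_congr rfl fun x _ => by rw [collapsePullback_of_notMem y x.2]
  · rw [Finset.sum_congr rfl fun (x : {e : E // ¬ e ∉ C}) _ => by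
      rw [collapsePullback_of_mem y (not_not.mp x.2)]]
    simp

theorem sum_collapsePullback_of_odd (hC : Odd C.card) (y : Fc E C → F2) :
    ∑ e, collapsePullback C y e = ∑ x, y x := by
  have h := sum_collapsePullback id y
  simp only [id] at h
  rw [h, nsmul_eq_mul, (ZMod.natCast_eq_one_iff_odd).2 hC]
  simp

theorem collapsePullback_mem_HE_iff (hC : Odd C.card) (y : Fc E C → F2) :
    collapsePullback C y ∈ HE E ↔ y ∈ HE (Fc E C) := by
  rw [mem_HE_iff, mem_HE_iff, sum_collapsePullback_of_odd hC]

theorem qE_collapsePullback (hC : C.card % 4 = 1) (y : Fc E C → F2) :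
    qE (collapsePullback C y) = qE y := by
  obtain ⟨k, hk⟩ : ∃ k, C.card = 1 + 4 * k := ⟨C.card / 4, by omega⟩
  have hw : weight (collapsePullback C y) =
      weight y + 4 * (k * if y (Sum.inr ()) = 1 then 1 else 0) := by
    rw [weight, sum_collapsePullback (fun a => if a = 1 then 1 else 0) y, hk, weight,
      Fintype.sum_sum_type, Fintype.sum_unique (ι := Unit), smul_eq_mul]
    change _ = _ + (if y (Sum.inr ()) = 1 then 1 else 0) + _
    ring
  rw [qE_eq_choose, qE_eq_choose, hw, natCast_choose_two_add_four_mul]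

theorem collapsePullback_injective (hC : C.Nonempty) :
    Function.Injective (collapsePullback C) := by
  intro y z h
  obtain ⟨c, hc⟩ := hC
  ext x
  rcases x with ⟨e, he⟩ | _
  · simpa only [collapsePullback_of_notMem _ he] using congrFun h e
  · simpa only [collapsePullback_of_mem _ hc] using congrFun h c

theorem bE_collapsePullback_eq_zero (hC : Odd C.card) {y : Fc E C → F2}
    (hy : y ∈ HE (Fc E C)) {u : E → F2} (hu : u ∈ HE E) (huC : ∀ e ∉ C, u e = 0) :
    bE (collapsePullback C y) u = 0 := by
  rw [bE_eq_sum ((collapsePullback_mem_HE_iff hC y).2 hy) hu]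
  have h : ∀ e, collapsePullback C y e * u e = y (Sum.inr ()) * u e := fun e => by
    by_cases he : e ∈ C
    · rw [collapsePullback_of_mem y he]
    · rw [huC e he, mul_zero, mul_zero]
  rw [Finset.sum_congr rfl fun e _ => h e, ← Finset.mul_sum, (mem_HE_iff u).1 hu, mul_zero]

theorem existsUnique_add_collapsePullback (hC : Odd C.card) {v : E → F2} (hv : v ∈ HE E) :
    ∃! p : (E → F2) × (Fc E C → F2),
      p.1 ∈ HE E ∧ (∀ e ∉ C, p.1 e = 0) ∧ p.2 ∈ HE (Fc E C) ∧
        v = p.1 + collapsePullback C p.2 := by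
  set y : Fc E C → F2 := Sum.elim (fun x => v x) (fun _ => ∑ x : {e : E // e ∉ C}, v x) with hy
  have hyF : y ∈ HE (Fc E C) := by
    rw [mem_HE_iff, Fintype.sum_sum_type]
    simp [hy, CharTwo.add_self_eq_zero]
  refine ⟨(v - collapsePullback C y, y),
    ⟨(HE E).sub_mem hv ((collapsePullback_mem_HE_iff hC y).2 hyF), fun e he => ?_, hyF,
      (sub_add_cancel _ _).symm⟩, ?_⟩
  · exact sub_eq_zero.2 (collapsePullback_of_notMem y he).symm
  · rintro ⟨u, z⟩ ⟨-, huC, hz, huz⟩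
    dsimp only at huC hz huz
    have hl : ∀ x : {e : E // e ∉ C}, z (Sum.inl x) = v x := fun x => by
      rw [huz, Pi.add_apply, huC x x.2, zero_add, collapsePullback_of_notMem z x.2]
    have hr : z (Sum.inr ()) = ∑ x : {e : E // e ∉ C}, v x := by
      rw [mem_HE_iff, Fintype.sum_sum_type, Finset.sum_congr rfl fun x _ => hl x] at hz
      exact (CharTwo.add_eq_zero.1 (by simpa using hz)).symm
    have hzy : z = y := by
      ext x
      rcases x with x | _
      · exact hl x
      · exact hr
    rw [← hzy, Prod.mk.injEq]
    exact ⟨eq_sub_of_add_eq huz.symm, rfl⟩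

end collapsePullback

/-- for `C ⊊ E` with `|C| ≡ 1 (mod 4)` and `F := (E∖C) ⊔ {∗}`, there is an
injective linear isometric embedding `ψ : H_F → H_E` whose image is orthogonal to `H_C`
(included by extension by 0) with `H_E = H_C ⊕ ψ(H_F)`. -/
theorem statement2 (E : Type*) [Fintype E] [DecidableEq E] (C : Finset E)
    (hproper : C ⊂ Finset.univ) (hmod : C.card % 4 = 1) :
    ∃ ψ : (Fc E C → F2) →ₗ[F2] (E → F2),
      (∀ y : Fc E C → F2, y ∈ HE (Fc E C) → ψ y ∈ HE E) ∧
      (∀ y : Fc E C → F2, y ∈ HE (Fc E C) → qE (ψ y) = qE y) ∧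
      Set.InjOn ψ (HE (Fc E C) : Set (Fc E C → F2)) ∧
      (∀ y : Fc E C → F2, y ∈ HE (Fc E C) →
        ∀ u : E → F2, u ∈ HE E → (∀ e ∉ C, u e = 0) → bE (ψ y) u = 0) ∧
      (∀ v : E → F2, v ∈ HE E →
        ∃! p : (E → F2) × (Fc E C → F2),
          p.1 ∈ HE E ∧ (∀ e ∉ C, p.1 e = 0) ∧ p.2 ∈ HE (Fc E C) ∧ v = p.1 + ψ p.2) := by
  have hodd : Odd C.card := Nat.odd_iff.2 (by omega)
  exact ⟨collapsePullback C, fun y hy => (collapsePullback_mem_HE_iff hodd y).2 hy,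
    fun y _ => qE_collapsePullback hmod y,
    (collapsePullback_injective (Finset.card_pos.1 hodd.pos)).injOn,
    fun y hy u hu huC => bE_collapsePullback_eq_zero hodd hy hu huC,
    fun v hv => existsUnique_add_collapsePullback hodd hv⟩
end

section
/- The Eisenstein lattice L₂ ⊥ L₃ ⊥ 𝓗 is isomorphic to L₁(2) ⊥ L₄ ⊥ 𝓗: there exists a 7×7 matrix U over 𝓔, invertible over 𝓔, such that Uᴴ · diag(G₂, G₃, G_H) · U = diag([6], G₄, G_H). -/
open Matrix

/-- `ω = (−1+√−3)/2`, a primitive cube root of unity in `ℂ`. -/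
noncomputable def ω : ℂ := (-1 + Complex.I * Real.sqrt 3) / 2

/-- `θ = ω − ω̄ = √−3`. -/
noncomputable def θ : ℂ := Complex.I * Real.sqrt 3

/-- The ring `𝓔 = ℤ[ω]` of Eisenstein integers, as a subring of `ℂ`. -/
def Eis : Subring ℂ := Subring.closure {ω}

/-- The Gram matrix `Gₙ` of the Eisenstein lattice `Lₙ`: diagonal entries `3`, entries
`θ` and `−θ` next to the diagonal, `0` elsewhere. -/
noncomputable def Gm (n : ℕ) : Matrix (Fin n) (Fin n) ℂ :=
  Matrix.of fun i j =>
    if i = j then 3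
    else if (i : ℕ) + 1 = (j : ℕ) then θ
    else if (j : ℕ) + 1 = (i : ℕ) then -θ
    else 0

/-- The Gram matrix of the hyperbolic Eisenstein lattice `𝓗`. -/
noncomputable def GH : Matrix (Fin 2) (Fin 2) ℂ := !![0, θ; -θ, 0]

/-- A matrix has all its entries in `𝓔`. -/
def EisEntries {m n : Type*} (U : Matrix m n ℂ) : Prop := ∀ i j, U i j ∈ Eis

/-- A (possibly rectangular) matrix is invertible over `𝓔`: it has a two-sided inverse
with entries in `𝓔`. -/
def EisInvertible {m n : Type*} [Fintype m] [Fintype n] [DecidableEq m] [DecidableEq n]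
    (U : Matrix m n ℂ) : Prop :=
  EisEntries U ∧ ∃ W : Matrix n m ℂ, EisEntries W ∧ U * W = 1 ∧ W * U = 1

theorem omega_mul_self : ω * ω = -1 - ω := by
  have h : (Real.sqrt 3 : ℂ) ^ 2 = 3 := by
    rw [← Complex.ofReal_pow, Real.sq_sqrt (by norm_num)]
    norm_num
  unfold ω
  linear_combination (Complex.I ^ 2 / 4) * h + (3 / 4) * Complex.I_sq

theorem star_omega : star ω = -1 - ω := by
  unfold ω
  simp only [Complex.star_def, map_div₀, map_add, map_mul, map_neg, map_one, Complex.conj_I,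
    Complex.conj_ofReal, map_ofNat]
  ring

theorem theta_eq : θ = 1 + 2 * ω := by
  unfold θ ω
  ring

/-- The Eisenstein integers, with computable arithmetic. -/
abbrev EisensteinInt : Type := QuadraticAlgebra ℤ (-1) (-1)

namespace EisensteinInt

/-- The embedding of the Eisenstein integers into `ℂ`. -/
noncomputable def toComplex : EisensteinInt →+* ℂ where
  toFun z := z.re + z.im * ω
  map_one' := by simp [QuadraticAlgebra.re_one, QuadraticAlgebra.im_one]
  map_zero' := by simp
  map_add' x y := by
    simp only [QuadraticAlgebra.re_add, QuadraticAlgebra.im_add, Int.cast_add]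
    ring
  map_mul' x y := by
    simp only [QuadraticAlgebra.re_mul, QuadraticAlgebra.im_mul, Int.cast_add, Int.cast_mul,
      Int.cast_neg, Int.cast_one]
    linear_combination (-(x.im * y.im : ℂ)) * omega_mul_self

theorem toComplex_apply (z : EisensteinInt) : toComplex z = z.re + z.im * ω := rfl

theorem toComplex_star (z : EisensteinInt) : toComplex (star z) = star (toComplex z) := by
  simp only [toComplex_apply, QuadraticAlgebra.re_star, QuadraticAlgebra.im_star, star_add,
    star_mul', star_omega, star_intCast, Int.cast_add, Int.cast_mul, Int.cast_neg, Int.cast_one]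
  ring

theorem toComplex_mem_Eis (z : EisensteinInt) : toComplex z ∈ Eis :=
  add_mem (intCast_mem _ _) (mul_mem (intCast_mem _ _) (Subring.subset_closure rfl))

theorem eisEntries_map {m n : Type*} (A : Matrix m n EisensteinInt) :
    EisEntries (A.map toComplex) :=
  fun i j => toComplex_mem_Eis (A i j)

theorem conjTranspose_map {m n : Type*} (A : Matrix m n EisensteinInt) :
    Aᴴ.map toComplex = (A.map toComplex)ᴴ := by
  ext i j
  exact toComplex_star (A j i)

theorem eisInvertible_map {m n : Type*} [Fintype m] [Fintype n] [DecidableEq m] [DecidableEq n]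
    {A : Matrix m n EisensteinInt} {B : Matrix n m EisensteinInt} (hAB : A * B = 1)
    (hBA : B * A = 1) : EisInvertible (A.map toComplex) :=
  ⟨eisEntries_map A, B.map toComplex, eisEntries_map B,
    by rw [← Matrix.map_mul, hAB, Matrix.map_one _ (map_zero _) (map_one _)],
    by rw [← Matrix.map_mul, hBA, Matrix.map_one _ (map_zero _) (map_one _)]⟩

/-- The Gram matrix `Gₙ` over the computable Eisenstein integers. -/
def gram (n : ℕ) : Matrix (Fin n) (Fin n) EisensteinInt :=
  Matrix.of fun i j =>
    if i = j then ⟨3, 0⟩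
    else if (i : ℕ) + 1 = (j : ℕ) then ⟨1, 2⟩
    else if (j : ℕ) + 1 = (i : ℕ) then ⟨-1, -2⟩
    else 0

/-- The Gram matrix of `𝓗` over the computable Eisenstein integers. -/
def gramHyperbolic : Matrix (Fin 2) (Fin 2) EisensteinInt := !![0, ⟨1, 2⟩; ⟨-1, -2⟩, 0]

theorem map_gram (n : ℕ) : (gram n).map toComplex = Gm n := by
  ext i j
  simp only [gram, Gm, Matrix.map_apply, Matrix.of_apply]
  split_ifs <;> (simp [toComplex_apply, theta_eq]; try ring)

theorem map_gramHyperbolic : gramHyperbolic.map toComplex = GH := by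
  ext i j
  fin_cases i <;> fin_cases j <;>
    (simp [gramHyperbolic, GH, toComplex_apply, theta_eq]; try ring)

/-- The Gram matrix of `L₂ ⊥ L₃ ⊥ 𝓗`. -/
def sourceGram : Matrix (Fin 2 ⊕ (Fin 3 ⊕ Fin 2)) (Fin 2 ⊕ (Fin 3 ⊕ Fin 2)) EisensteinInt :=
  Matrix.fromBlocks (gram 2) 0 0 (Matrix.fromBlocks (gram 3) 0 0 gramHyperbolic)

/-- The Gram matrix of `L₁(2) ⊥ L₄ ⊥ 𝓗`. -/
def targetGram : Matrix (Fin 1 ⊕ (Fin 4 ⊕ Fin 2)) (Fin 1 ⊕ (Fin 4 ⊕ Fin 2)) EisensteinInt :=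
  Matrix.fromBlocks !![⟨6, 0⟩] 0 0 (Matrix.fromBlocks (gram 4) 0 0 gramHyperbolic)

theorem map_sourceGram : sourceGram.map toComplex =
    Matrix.fromBlocks (Gm 2) 0 0 (Matrix.fromBlocks (Gm 3) 0 0 GH) := by
  simp [sourceGram, Matrix.fromBlocks_map, map_gram, map_gramHyperbolic]

theorem map_targetGram : targetGram.map toComplex =
    Matrix.fromBlocks !![(6 : ℂ)] 0 0 (Matrix.fromBlocks (Gm 4) 0 0 GH) := by
  have h : !![(⟨6, 0⟩ : EisensteinInt)].map toComplex = !![(6 : ℂ)] := by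
    ext i j
    simp [toComplex_apply]
  simp [targetGram, Matrix.fromBlocks_map, map_gram, map_gramHyperbolic, h]

/-- The position in `Fin 7` of an index of `sourceGram`. -/
def sourceIndex : Fin 2 ⊕ (Fin 3 ⊕ Fin 2) → Fin 7 :=
  Sum.elim ![0, 1] (Sum.elim ![2, 3, 4] ![5, 6])

/-- The position in `Fin 7` of an index of `targetGram`. -/
def targetIndex : Fin 1 ⊕ (Fin 4 ⊕ Fin 2) → Fin 7 :=
  Sum.elim ![0] (Sum.elim ![1, 2, 3, 4] ![5, 6])

/-- The change of basis from `L₂ ⊥ L₃ ⊥ 𝓗` to `L₁(2) ⊥ L₄ ⊥ 𝓗`. -/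
def baseChange : Matrix (Fin 2 ⊕ (Fin 3 ⊕ Fin 2)) (Fin 1 ⊕ (Fin 4 ⊕ Fin 2)) EisensteinInt :=
  Matrix.submatrix
    !![⟨3, 0⟩, ⟨0, 0⟩, ⟨0, 0⟩, ⟨0, 0⟩, ⟨-1, 0⟩, ⟨-1, 0⟩, ⟨1, 2⟩;
      ⟨1, 2⟩, ⟨0, 0⟩, ⟨0, 0⟩, ⟨0, 0⟩, ⟨0, 0⟩, ⟨0, 0⟩, ⟨-1, 0⟩;
      ⟨4, 0⟩, ⟨0, 0⟩, ⟨1, 0⟩, ⟨0, 0⟩, ⟨0, 0⟩, ⟨-2, 0⟩, ⟨1, 2⟩;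
      ⟨2, 4⟩, ⟨-1, 0⟩, ⟨0, 0⟩, ⟨0, 0⟩, ⟨0, 0⟩, ⟨-1, -2⟩, ⟨-1, 0⟩;
      ⟨-2, 0⟩, ⟨0, 0⟩, ⟨0, 0⟩, ⟨0, 0⟩, ⟨0, 0⟩, ⟨1, 0⟩, ⟨0, 0⟩;
      ⟨2, 4⟩, ⟨0, 0⟩, ⟨0, 1⟩, ⟨-1, -1⟩, ⟨0, -1⟩, ⟨-1, -2⟩, ⟨-2, 0⟩;
      ⟨-4, -2⟩, ⟨0, 0⟩, ⟨0, 0⟩, ⟨0, 1⟩, ⟨0, 0⟩, ⟨2, 1⟩, ⟨0, -2⟩]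
    sourceIndex targetIndex

/-- The inverse of `baseChange`. -/
def baseChangeInv : Matrix (Fin 1 ⊕ (Fin 4 ⊕ Fin 2)) (Fin 2 ⊕ (Fin 3 ⊕ Fin 2)) EisensteinInt :=
  Matrix.submatrix
    !![⟨1, 0⟩, ⟨0, 0⟩, ⟨1, 0⟩, ⟨0, 0⟩, ⟨0, 0⟩, ⟨1, 1⟩, ⟨1, 0⟩;
      ⟨-1, -2⟩, ⟨1, 0⟩, ⟨-1, -2⟩, ⟨-1, 0⟩, ⟨-1, -2⟩, ⟨1, -1⟩, ⟨-1, -2⟩;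
      ⟨3, 0⟩, ⟨1, 2⟩, ⟨4, 0⟩, ⟨0, 0⟩, ⟨2, 0⟩, ⟨3, 3⟩, ⟨3, 0⟩;
      ⟨2, 4⟩, ⟨-2, 0⟩, ⟨2, 4⟩, ⟨0, 0⟩, ⟨1, 2⟩, ⟨-2, 2⟩, ⟨1, 3⟩;
      ⟨-3, 0⟩, ⟨-1, -2⟩, ⟨-2, 0⟩, ⟨0, 0⟩, ⟨-1, 0⟩, ⟨-2, -2⟩, ⟨-2, 0⟩;
      ⟨2, 0⟩, ⟨0, 0⟩, ⟨2, 0⟩, ⟨0, 0⟩, ⟨1, 0⟩, ⟨2, 2⟩, ⟨2, 0⟩;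
      ⟨1, 2⟩, ⟨-1, 0⟩, ⟨1, 2⟩, ⟨0, 0⟩, ⟨0, 0⟩, ⟨-1, 1⟩, ⟨1, 2⟩]
    targetIndex sourceIndex

theorem baseChange_mul_inv : baseChange * baseChangeInv = 1 := by
  decide +kernel

theorem baseChangeInv_mul : baseChangeInv * baseChange = 1 := by
  decide +kernel

theorem conjTranspose_baseChange_mul_sourceGram_mul :
    baseChangeᴴ * sourceGram * baseChange = targetGram := by
  decide +kernel

end EisensteinInt

/-- Statement 17: `L₂ ⊥ L₃ ⊥ 𝓗 ≅ L₁(2) ⊥ L₄ ⊥ 𝓗`. -/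
theorem statement17 :
    ∃ U : Matrix (Fin 2 ⊕ (Fin 3 ⊕ Fin 2)) (Fin 1 ⊕ (Fin 4 ⊕ Fin 2)) ℂ,
      EisInvertible U ∧
      Uᴴ * Matrix.fromBlocks (Gm 2) 0 0 (Matrix.fromBlocks (Gm 3) 0 0 GH) * U =
        Matrix.fromBlocks !![(6 : ℂ)] 0 0 (Matrix.fromBlocks (Gm 4) 0 0 GH) := by
  open EisensteinInt in
  refine ⟨baseChange.map toComplex, eisInvertible_map baseChange_mul_inv baseChangeInv_mul, ?_⟩
  rw [← map_sourceGram, ← map_targetGram, ← conjTranspose_map, ← Matrix.map_mul,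
    ← Matrix.map_mul, conjTranspose_baseChange_mul_sourceGram_mul]
end
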